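/- arXiv:2311.14259 — 3 statements merged into one kernel-verified Lean document; each statement's English description precedes it below -/
import Mathlib

section
/- For every nonnegative integer t, the X-trees X(10 + 12t, 9 + 12t, 6 + 12t, 2) and X(11 + 12t, 10 + 12t, 7 + 12t, 1), i.e., the starlike trees S(10 + 12t, 9 + 12t, 6 + 12t, 2) and S(11 + 12t, 10 + 12t, 7 + 12t, 1), are both transmission irregular. -/
/-- The transmission of a vertex: sum of distances to all other vertices. -/
noncomputable def transmission {V : Type*} [Fintype V] (G : SimpleGraph V) (u : V) : ℕ :=
  ∑ v : V, G.dist u v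

/-- A graph is transmission irregular if all vertices have distinct transmissions. -/
def TransmissionIrregular {V : Type*} [Fintype V] (G : SimpleGraph V) : Prop :=
  Function.Injective (transmission G)

/-- The starlike tree `S(A 0, …, A (k-1))`: a central vertex (`none`) with `k`
pendent paths attached, the `i`-th of length `A i`; `some ⟨i, j⟩` is the
`(j+1)`-st vertex on the `i`-th pendent path. -/
def starlikeTree (k : ℕ) (A : Fin k → ℕ) :
    SimpleGraph (Option ((i : Fin k) × Fin (A i))) :=
  SimpleGraph.fromRel (fun x y =>
    match x, y with
    | none, some ⟨_, j⟩ => j.val = 0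
    | some ⟨i, j⟩, some ⟨i', j'⟩ => i.val = i'.val ∧ j.val + 1 = j'.val
    | _, _ => False)

open Finset in
theorem sum_range_abs_sub (j A : ℕ) (h : j < A) :
    ∑ m ∈ range A, |(j : ℤ) - m| = ∑ m ∈ range A, ((m : ℤ) + 1) + (j + 1) * (j - A) := by
  have initial (B : ℕ) (hB : B ≤ j + 1) :
      ∑ m ∈ range B, |(j : ℤ) - m| = ∑ m ∈ range B, ((m : ℤ) + 1) + B * (j - B) := by
    induction B with
    | zero => simp
    | succ B ih =>
      rw [sum_range_succ, sum_range_succ, ih (by omega), abs_of_nonneg (by omega)]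
      push_cast
      ring
  induction A, h using Nat.le_induction with
  | base => simpa using initial (j + 1) le_rfl
  | succ A h ih =>
    rw [sum_range_succ, sum_range_succ, ih, abs_of_nonpos (by omega)]
    push_cast
    ring

/-- A vertex function that vanishes only at `u`, varies by at most one along edges and decreases
along some edge at every other vertex is the distance from `u`. -/
theorem SimpleGraph.dist_eq_of_lipschitz_of_descent {V : Type*} (G : SimpleGraph V) (u : V)
    (f : V → ℕ) (hu : f u = 0) (hzero : ∀ v, f v = 0 → v = u)
    (hlip : ∀ v w, G.Adj v w → f w ≤ f v + 1)
    (hdesc : ∀ v, f v ≠ 0 → ∃ w, G.Adj w v ∧ f w + 1 = f v) (v : V) :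
    G.dist u v = f v := by
  have lower (a b : V) (p : G.Walk a b) : f b ≤ f a + p.length := by
    induction p with
    | nil => simp
    | cons h p ih =>
      have := hlip _ _ h
      rw [SimpleGraph.Walk.length_cons]
      omega
  have upper (n : ℕ) : ∀ v, f v = n → ∃ p : G.Walk u v, p.length = n := by
    induction n with
    | zero =>
      intro v hv
      obtain rfl := hzero v hv
      exact ⟨.nil, rfl⟩
    | succ n ih =>
      intro v hv
      obtain ⟨w, hwv, hw⟩ := hdesc v (by omega)
      obtain ⟨p, hp⟩ := ih w (by omega)
      exact ⟨p.concat hwv, by rw [SimpleGraph.Walk.length_concat, hp]⟩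
  obtain ⟨p, hp⟩ := upper _ v rfl
  obtain ⟨q, hq⟩ := p.reachable.exists_walk_length_eq_dist
  have h₁ := SimpleGraph.dist_le p
  have h₂ := lower u v q
  omega

namespace starlikeTree

variable {k : ℕ} {A : Fin k → ℕ}

/-- The distance in a starlike tree, in coordinates. -/
def coordDist : Option ((i : Fin k) × Fin (A i)) → Option ((i : Fin k) × Fin (A i)) → ℕ
  | none, none => 0
  | none, some y => y.2.val + 1
  | some x, none => x.2.val + 1
  | some x, some y =>
    if x.1 = y.1 then (x.2.val - y.2.val) + (y.2.val - x.2.val) else x.2.val + y.2.val + 2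

theorem adj_none_some (i : Fin k) (j : Fin (A i)) :
    (starlikeTree k A).Adj none (some ⟨i, j⟩) ↔ j.val = 0 := by
  simp [starlikeTree]

theorem adj_some_some (i i' : Fin k) (j : Fin (A i)) (j' : Fin (A i')) :
    (starlikeTree k A).Adj (some ⟨i, j⟩) (some ⟨i', j'⟩) ↔
      i = i' ∧ (j.val + 1 = j'.val ∨ j'.val + 1 = j.val) := by
  simp only [starlikeTree, SimpleGraph.fromRel_adj, ne_eq, Option.some.injEq, Fin.val_inj]
  constructor
  · rintro ⟨-, ⟨rfl, h⟩ | ⟨rfl, h⟩⟩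
    · exact ⟨rfl, .inl h⟩
    · exact ⟨rfl, .inr h⟩
  · rintro ⟨rfl, h⟩
    refine ⟨fun e => ?_, h.imp (⟨rfl, ·⟩) (⟨rfl, ·⟩)⟩
    cases e
    omega

theorem coordDist_lipschitz (u v w : Option ((i : Fin k) × Fin (A i)))
    (h : (starlikeTree k A).Adj v w) : coordDist u w ≤ coordDist u v + 1 := by
  rcases v with _ | ⟨i, j⟩ <;> rcases w with _ | ⟨i', j'⟩
  · exact absurd h (SimpleGraph.irrefl _)
  · rw [adj_none_some] at h
    rcases u with _ | ⟨a, b⟩ <;> simp only [coordDist]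
    · omega
    · split_ifs <;> omega
  · rw [SimpleGraph.adj_comm, adj_none_some] at h
    rcases u with _ | ⟨a, b⟩ <;> simp only [coordDist]
    · omega
    · split_ifs <;> omega
  · rw [adj_some_some] at h
    obtain ⟨rfl, h⟩ := h
    rcases u with _ | ⟨a, b⟩ <;> simp only [coordDist]
    · omega
    · split_ifs <;> omega

theorem exists_adj_coordDist_add_one (u v : Option ((i : Fin k) × Fin (A i)))
    (h : coordDist u v ≠ 0) :
    ∃ w, (starlikeTree k A).Adj w v ∧ coordDist u w + 1 = coordDist u v := by
  rcases v with _ | ⟨i, j, hj⟩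
  · rcases u with _ | ⟨a, b, hb⟩
    · exact absurd rfl h
    · refine ⟨some ⟨a, 0, by omega⟩, ?_, ?_⟩
      · rw [SimpleGraph.adj_comm, adj_none_some]
      · simp [coordDist]
  · by_cases hout : ∃ b : Fin (A i), u = some ⟨i, b⟩ ∧ j < b.val
    · obtain ⟨⟨b, hb⟩, rfl, hjb⟩ := hout
      simp only at hjb
      refine ⟨some ⟨i, j + 1, by omega⟩, ?_, ?_⟩
      · rw [adj_some_some]
        simp
      · simp only [coordDist, if_true]
        omega
    · rcases j with _ | j
      · refine ⟨none, by rw [adj_none_some], ?_⟩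
        rcases u with _ | ⟨a, b, hb⟩
        · simp [coordDist]
        · by_cases ha : a = i
          · subst ha
            simp only [coordDist, if_true] at h
            exact absurd ⟨⟨b, hb⟩, rfl, by simp only; omega⟩ hout
          · simp only [coordDist, if_neg ha]
      · refine ⟨some ⟨i, j, by omega⟩, ?_, ?_⟩
        · rw [adj_some_some]
          simp
        · rcases u with _ | ⟨a, b, hb⟩
          · simp [coordDist]
          · by_cases ha : a = i
            · subst ha
              simp only [coordDist, if_true] at h ⊢
              have : ¬ j + 1 < b := fun hlt => hout ⟨⟨b, hb⟩, rfl, hlt⟩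
              omega
            · simp only [coordDist, if_neg ha]
              omega

theorem eq_of_coordDist_eq_zero (u v : Option ((i : Fin k) × Fin (A i)))
    (h : coordDist u v = 0) : v = u := by
  rcases u with _ | ⟨a, b⟩ <;> rcases v with _ | ⟨i, j⟩ <;> simp only [coordDist] at h
  · rfl
  · omega
  · omega
  · split_ifs at h with hai
    subst hai
    obtain rfl : b = j := Fin.ext (by omega)
    rfl

theorem dist_eq_coordDist (u v : Option ((i : Fin k) × Fin (A i))) :
    (starlikeTree k A).dist u v = coordDist u v := by
  refine SimpleGraph.dist_eq_of_lipschitz_of_descent _ u (coordDist u) ?_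
    (eq_of_coordDist_eq_zero u) (coordDist_lipschitz u) (exists_adj_coordDist_add_one u) v
  rcases u with _ | ⟨a, b⟩ <;> simp [coordDist]

/-- The difference between the transmission of the vertex at distance `x` from the center on the
`i`-th branch and the transmission of the center. -/
def excess (A : Fin k → ℕ) (i : Fin k) (x : ℤ) : ℤ :=
  x * ((∑ m, (A m : ℤ)) - 2 * A i + x)

theorem transmission_some (i : Fin k) (j : Fin (A i)) :
    (transmission (starlikeTree k A) (some ⟨i, j⟩) : ℤ) =
      transmission (starlikeTree k A) none + excess A i (j.val + 1) := by
  have branch (m : Fin k) :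
      ∑ y : Fin (A m), (coordDist (some ⟨i, j⟩) (some ⟨m, y⟩) : ℤ) =
        ∑ y : Fin (A m), ((y.val : ℤ) + 1) + (j.val + 1) * A m +
          if i = m then ((j.val : ℤ) + 1) * (j.val - 2 * A i) else 0 := by
    by_cases h : i = m
    · subst h
      have hterm (y : Fin (A i)) :
          (coordDist (some ⟨i, j⟩) (some ⟨i, y⟩) : ℤ) = |(j.val : ℤ) - y.val| := by
        simp only [coordDist, if_true]
        rcases le_total j.val y.val with h | h
        · rw [abs_of_nonpos (by omega)]
          omega
        · rw [abs_of_nonneg (by omega)]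
          omega
      simp only [hterm, if_true]
      rw [Fin.sum_univ_eq_sum_range (fun y => |(j.val : ℤ) - y|),
        Fin.sum_univ_eq_sum_range (fun y => (y : ℤ) + 1), sum_range_abs_sub _ _ j.isLt]
      ring
    · have hterm (y : Fin (A m)) : (coordDist (some ⟨i, j⟩) (some ⟨m, y⟩) : ℤ) =
          ((y.val : ℤ) + 1) + (j.val + 1) := by
        simp only [coordDist, if_neg h]
        push_cast
        ring
      simp only [hterm, if_neg h, Finset.sum_add_distrib, Finset.sum_const, Finset.card_univ,
        Fintype.card_fin, nsmul_eq_mul]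
      ring
  simp only [transmission, dist_eq_coordDist, Fintype.sum_option, Fintype.sum_sigma]
  push_cast
  simp only [branch, Finset.sum_add_distrib, Finset.sum_ite_eq, Finset.mem_univ, if_true,
    ← Finset.mul_sum, excess]
  simp only [coordDist, Nat.cast_add, Nat.cast_one, Nat.cast_zero, Finset.sum_add_distrib]
  ring

theorem transmissionIrregular_of_excess_ne (hA : ∀ i, 2 * A i ≤ ∑ m, A m)
    (hne : ∀ i i', i < i' → ∀ x y : ℤ, 1 ≤ x → x ≤ A i → 1 ≤ y → y ≤ A i' →
      excess A i x ≠ excess A i' y) :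
    TransmissionIrregular (starlikeTree k A) := by
  have slope (i : Fin k) : (0 : ℤ) ≤ (∑ m, (A m : ℤ)) - 2 * A i := by
    have := hA i
    zify at this
    linarith
  have pos (i : Fin k) (j : Fin (A i)) : 0 < excess A i (j.val + 1) := by
    have := slope i
    unfold excess
    positivity
  intro u v huv
  replace huv : (transmission (starlikeTree k A) u : ℤ) = transmission (starlikeTree k A) v := by
    rw [huv]
  rcases u with _ | ⟨i, j⟩ <;> rcases v with _ | ⟨i', j'⟩
  · rfl
  · rw [transmission_some] at huv
    linarith [pos i' j']
  · rw [transmission_some] at huv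
    linarith [pos i j]
  · rw [transmission_some, transmission_some, add_right_inj] at huv
    have hj := j.isLt
    have hj' := j'.isLt
    rcases lt_trichotomy i i' with h | rfl | h
    · exact absurd huv (hne _ _ h _ _ (by omega) (by omega) (by omega) (by omega))
    · have hs := slope i
      unfold excess at huv
      have hval : (j.val : ℤ) = j'.val := by
        have hfac : ((j.val : ℤ) - j'.val) *
            ((∑ m, (A m : ℤ)) - 2 * A i + (j.val + 1) + (j'.val + 1)) = 0 := by
          linear_combination huv
        rcases mul_eq_zero.mp hfac with h | h
        · linarith
        · have : (0 : ℤ) ≤ j.val := by positivity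
          have : (0 : ℤ) ≤ j'.val := by positivity
          linarith
      obtain rfl : j = j' := Fin.ext (by exact_mod_cast hval)
      rfl
    · exact absurd huv.symm (hne _ _ h _ _ (by omega) (by omega) (by omega) (by omega))

end starlikeTree

theorem mul_add_seven_ne_mul_add_nine (c x y : ℤ) (hc : 0 ≤ c) (hx : 1 ≤ x) (hy : 1 ≤ y) :
    x * (c + 7 + x) ≠ y * (c + 9 + y) := by
  intro h
  have hfac : (y - x + 1) * (x + y + c + 8) = c + 8 := by linear_combination -h
  rcases le_or_gt (y - x + 1) 0 with hm | hm <;> nlinarith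

theorem mul_add_seven_ne_mul_add_fifteen (t x y : ℤ) (ht : 0 ≤ t) (hx : 1 ≤ x) (hy : 1 ≤ y)
    (hy' : y ≤ 12 * t + 7) : x * (12 * t + 7 + x) ≠ y * (12 * t + 15 + y) := by
  intro h
  obtain ⟨m, rfl⟩ : ∃ m, x = y + 4 - m := ⟨y - x + 4, by ring⟩
  have hfac : m * (2 * y + 4 - m + 12 * t + 11) = 4 * (12 * t + 11) := by
    linear_combination -h
  have hm : 0 < m := by
    by_contra! hm
    nlinarith
  have hm' : m < 4 := by
    by_contra! hm
    nlinarith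
  interval_cases m <;> omega

theorem mul_add_nine_ne_mul_add_fifteen (t x y : ℤ) (ht : 0 ≤ t) (hx : 1 ≤ x) (hy : 1 ≤ y)
    (hy' : y ≤ 12 * t + 7) : x * (12 * t + 9 + x) ≠ y * (12 * t + 15 + y) := by
  intro h
  obtain ⟨m, rfl⟩ : ∃ m, x = y + 3 - m := ⟨y - x + 3, by ring⟩
  have hfac : m * (2 * y + 3 - m + 12 * t + 12) = 3 * (12 * t + 12) := by
    linear_combination -h
  have hm : 0 < m := by
    by_contra! hm
    nlinarith
  have hm' : m < 3 := by
    by_contra! hm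
    nlinarith
  interval_cases m <;> omega

/-- The vertices of a branch of slope at least `12 * t + 7` do not match a small fourth branch. -/
theorem mul_add_ne_of_le (t b x v : ℤ) (ht : 0 ≤ t)
    (hb : b = 12 * t + 7 ∨ b = 12 * t + 9 ∨ b = 12 * t + 15) (hx : 1 ≤ x)
    (hv : v = 36 * t + 24 ∨ v = 72 * t + 50 ∨ v = 36 * t + 28) : x * (b + x) ≠ v := by
  intro h
  have hx6 : x < 6 := by
    by_contra! hx6
    have : 6 * (b + 6) ≤ x * (b + x) := by
      gcongr
      omega
    omega
  interval_cases x <;> omega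

/-- For every nonnegative integer `t`, the X-trees `X(10+12t, 9+12t, 6+12t, 2)` and
`X(11+12t, 10+12t, 7+12t, 1)` are both transmission irregular. -/
theorem xTree_families_three_four_TI (t : ℕ) :
    TransmissionIrregular (starlikeTree 4 ![10 + 12 * t, 9 + 12 * t, 6 + 12 * t, 2]) ∧
    TransmissionIrregular (starlikeTree 4 ![11 + 12 * t, 10 + 12 * t, 7 + 12 * t, 1]) := by
  have ht : (0 : ℤ) ≤ t := by positivity
  constructor
  · refine starlikeTree.transmissionIrregular_of_excess_ne ?_ ?_
    · intro i
      fin_cases i <;> simp [Fin.sum_univ_four] <;> omega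
    · intro i i' hlt x y hx hxA hy hyA h
      fin_cases i <;> fin_cases i' <;> simp at hlt <;>
        simp [starlikeTree.excess, Fin.sum_univ_four] at hxA hyA h
      · exact mul_add_seven_ne_mul_add_nine (12 * t) x y (by omega) hx hy
          (by linear_combination h)
      · exact mul_add_seven_ne_mul_add_fifteen t x y ht hx hy (by omega)
          (by linear_combination h)
      · refine mul_add_ne_of_le t (12 * t + 7) x (y * (36 * t + 23 + y)) ht (by simp) hx ?_ (by linear_combination h)
        interval_cases y <;> omega
      · exact mul_add_nine_ne_mul_add_fifteen t x y ht hx hy (by omega)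
          (by linear_combination h)
      · refine mul_add_ne_of_le t (12 * t + 9) x (y * (36 * t + 23 + y)) ht (by simp) hx ?_ (by linear_combination h)
        interval_cases y <;> omega
      · refine mul_add_ne_of_le t (12 * t + 15) x (y * (36 * t + 23 + y)) ht (by simp) hx ?_ (by linear_combination h)
        interval_cases y <;> omega
  · refine starlikeTree.transmissionIrregular_of_excess_ne ?_ ?_
    · intro i
      fin_cases i <;> simp [Fin.sum_univ_four] <;> omega
    · intro i i' hlt x y hx hxA hy hyA h
      fin_cases i <;> fin_cases i' <;> simp at hlt <;>
        simp [starlikeTree.excess, Fin.sum_univ_four] at hxA hyA h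
      · exact mul_add_seven_ne_mul_add_nine (12 * t) x y (by omega) hx hy
          (by linear_combination h)
      · exact mul_add_seven_ne_mul_add_fifteen t x y ht hx hy (by omega)
          (by linear_combination h)
      · refine mul_add_ne_of_le t (12 * t + 7) x (y * (36 * t + 27 + y)) ht (by simp) hx ?_ (by linear_combination h)
        interval_cases y
        omega
      · exact mul_add_nine_ne_mul_add_fifteen t x y ht hx hy (by omega)
          (by linear_combination h)
      · refine mul_add_ne_of_le t (12 * t + 9) x (y * (36 * t + 27 + y)) ht (by simp) hx ?_ (by linear_combination h)
        interval_cases y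
        omega
      · refine mul_add_ne_of_le t (12 * t + 15) x (y * (36 * t + 27 + y)) ht (by simp) hx ?_ (by linear_combination h)
        interval_cases y
        omega
end

section
/- For every nonnegative integer t, the H-tree H(1 + t; 6 + 2t, 5 + 2t; 2 + t, 1), i.e., the double starlike tree DS(1 + t; 6 + 2t, 5 + 2t; 2 + t, 1), is transmission irregular. -/
/-- The double starlike tree `DS(C; A; B)`: an internal path `Sum.inl 0, …, Sum.inl C`
of length `C`, with `k` pendent paths of lengths `A i` attached at `Sum.inl 0`
(vertices `Sum.inr (Sum.inl ⟨i, j⟩)`), and `m` pendent paths of lengths `B i`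
attached at `Sum.inl C` (vertices `Sum.inr (Sum.inr ⟨i, j⟩)`). -/
def doubleStarlikeTree (C k m : ℕ) (A : Fin k → ℕ) (B : Fin m → ℕ) :
    SimpleGraph (Fin (C + 1) ⊕ ((i : Fin k) × Fin (A i)) ⊕ ((i : Fin m) × Fin (B i))) :=
  SimpleGraph.fromRel (fun x y =>
    match x, y with
    | Sum.inl c, Sum.inl c' => c.val + 1 = c'.val
    | Sum.inl c, Sum.inr (Sum.inl ⟨_, j⟩) => c.val = 0 ∧ j.val = 0
    | Sum.inl c, Sum.inr (Sum.inr ⟨_, j⟩) => c.val = C ∧ j.val = 0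
    | Sum.inr (Sum.inl ⟨i, j⟩), Sum.inr (Sum.inl ⟨i', j'⟩) => i.val = i'.val ∧ j.val + 1 = j'.val
    | Sum.inr (Sum.inr ⟨i, j⟩), Sum.inr (Sum.inr ⟨i', j'⟩) => i.val = i'.val ∧ j.val + 1 = j'.val
    | _, _ => False)

/-- A function that vanishes only at `u`, grows by at most one along every edge and decreases by
one along some edge out of every other vertex is the distance from `u`. -/
theorem SimpleGraph.dist_eq_of_descent {V : Type*} {G : SimpleGraph V} {u : V} (d : V → ℕ)
    (hu : d u = 0) (hlip : ∀ v w, G.Adj v w → d w ≤ d v + 1)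
    (hdesc : ∀ v, v ≠ u → ∃ w, G.Adj w v ∧ d w + 1 = d v) (v : V) :
    G.dist u v = d v := by
  have hle : ∀ {x y : V} (p : G.Walk x y), d y ≤ d x + p.length := by
    intro x y p
    induction p with
    | nil => simp
    | cons h p ih =>
      have := hlip _ _ h
      rw [SimpleGraph.Walk.length_cons]
      omega
  have hwalk : ∀ n v, d v = n → ∃ p : G.Walk u v, p.length = n := by
    intro n
    induction n with
    | zero =>
      intro v hv
      by_cases h : v = u
      · subst h
        exact ⟨.nil, rfl⟩
      · obtain ⟨w, -, hw⟩ := hdesc v h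
        omega
    | succ n ih =>
      intro v hv
      have h : v ≠ u := by
        rintro rfl
        omega
      obtain ⟨w, hadj, hw⟩ := hdesc v h
      obtain ⟨p, hp⟩ := ih w (by omega)
      exact ⟨p.concat hadj, by simp [hp]⟩
  obtain ⟨p, hp⟩ := hwalk _ v rfl
  obtain ⟨q, hq⟩ := p.reachable.exists_walk_length_eq_dist
  have h₁ := hle q
  have h₂ := SimpleGraph.dist_le p
  omega

theorem two_mul_sum_fin_add (n a : ℕ) :
    2 * ∑ i : Fin n, (a + i.val) = n * (2 * a) + n * (n - 1) := by
  rw [Finset.sum_add_distrib, Fin.sum_univ_eq_sum_range (fun i => i), mul_add,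
    mul_comm 2 (∑ i ∈ Finset.range n, i), Finset.sum_range_id_mul_two]
  simp
  ring

theorem two_mul_sum_fin_natDist (n j : ℕ) (hj : j ≤ n) :
    2 * ∑ i : Fin n, Nat.dist j i.val = j * (j + 1) + (n - j) * (n - j - 1) := by
  rw [Fin.sum_univ_eq_sum_range (fun i => Nat.dist j i)]
  obtain ⟨m, rfl⟩ := Nat.exists_eq_add_of_le hj
  rw [Finset.sum_range_add]
  have h₁ : ∀ i ∈ Finset.range m, Nat.dist j (j + i) = i := by
    intro i _
    simp [Nat.dist]
  have h₂ : ∀ i ∈ Finset.range j, Nat.dist j i = (j - 1 - i) + 1 := by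
    intro i hi
    have := Finset.mem_range.1 hi
    simp only [Nat.dist]
    omega
  rw [Finset.sum_congr rfl h₁, Finset.sum_congr rfl h₂, Finset.sum_add_distrib,
    Finset.sum_range_reflect (fun i => i) j, mul_add, mul_add,
    mul_comm 2 (∑ i ∈ Finset.range j, i), mul_comm 2 (∑ i ∈ Finset.range m, i),
    Finset.sum_range_id_mul_two, Finset.sum_range_id_mul_two]
  rcases j with _ | j <;> simp
  ring

namespace doubleStarlikeTree

variable {C k m : ℕ} {A : Fin k → ℕ} {B : Fin m → ℕ}

/-- The explicit distance between two vertices of `doubleStarlikeTree C k m A B`. -/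
def vertexDist (C : ℕ) {k m : ℕ} {A : Fin k → ℕ} {B : Fin m → ℕ} :
    (Fin (C + 1) ⊕ ((i : Fin k) × Fin (A i)) ⊕ ((i : Fin m) × Fin (B i))) →
    (Fin (C + 1) ⊕ ((i : Fin k) × Fin (A i)) ⊕ ((i : Fin m) × Fin (B i))) → ℕ
  | .inl c, .inl c' => Nat.dist c.val c'.val
  | .inl c, .inr (.inl ⟨_, j⟩) => c.val + 1 + j.val
  | .inl c, .inr (.inr ⟨_, j⟩) => C - c.val + 1 + j.val
  | .inr (.inl ⟨_, j⟩), .inl c => j.val + 1 + c.val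
  | .inr (.inl ⟨i, j⟩), .inr (.inl ⟨i', j'⟩) =>
    if i' = i then Nat.dist j.val j'.val else j.val + 2 + j'.val
  | .inr (.inl ⟨_, j⟩), .inr (.inr ⟨_, j'⟩) => j.val + C + 2 + j'.val
  | .inr (.inr ⟨_, j⟩), .inl c => j.val + 1 + (C - c.val)
  | .inr (.inr ⟨_, j⟩), .inr (.inl ⟨_, j'⟩) => j.val + C + 2 + j'.val
  | .inr (.inr ⟨i, j⟩), .inr (.inr ⟨i', j'⟩) =>
    if i' = i then Nat.dist j.val j'.val else j.val + 2 + j'.val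

theorem vertexDist_le_of_adj
    (u v w : Fin (C + 1) ⊕ ((i : Fin k) × Fin (A i)) ⊕ ((i : Fin m) × Fin (B i)))
    (h : (doubleStarlikeTree C k m A B).Adj v w) :
    vertexDist C u w ≤ vertexDist C u v + 1 := by
  rcases u with c₀ | ⟨i₀, j₀⟩ | ⟨i₀, j₀⟩ <;> rcases v with c | ⟨i, j⟩ | ⟨i, j⟩ <;>
    rcases w with c' | ⟨i', j'⟩ | ⟨i', j'⟩ <;>
    simp only [doubleStarlikeTree, SimpleGraph.fromRel_adj, vertexDist, Nat.dist, Fin.ext_iff,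
      or_false, false_or, and_false] at h ⊢ <;>
    first
    | omega
    | (split_ifs <;> omega)

theorem exists_adj_vertexDist
    (u v : Fin (C + 1) ⊕ ((i : Fin k) × Fin (A i)) ⊕ ((i : Fin m) × Fin (B i))) (h : v ≠ u) :
    ∃ w, (doubleStarlikeTree C k m A B).Adj w v ∧ vertexDist C u w + 1 = vertexDist C u v := by
  rcases v with c | ⟨i, j⟩ | ⟨i, j⟩
  · rcases u with c₀ | ⟨i₀, j₀⟩ | ⟨i₀, j₀⟩
    · have hne : c.val ≠ c₀.val := fun h' => h (by rw [Fin.ext h'])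
      rcases lt_or_gt_of_ne hne with hlt | hlt
      · refine ⟨.inl ⟨c + 1, by omega⟩, ?_⟩
        simp [doubleStarlikeTree, vertexDist, Nat.dist, Fin.ext_iff, -Fin.val_eq_zero_iff]
        omega
      · refine ⟨.inl ⟨c - 1, by omega⟩, ?_⟩
        simp [doubleStarlikeTree, vertexDist, Nat.dist, Fin.ext_iff, -Fin.val_eq_zero_iff]
        omega
    · by_cases hc : c.val = 0
      · refine ⟨.inr (.inl ⟨i₀, ⟨0, j₀.pos⟩⟩), ?_⟩
        simp [doubleStarlikeTree, vertexDist, Nat.dist, hc, -Fin.val_eq_zero_iff]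
      · refine ⟨.inl ⟨c - 1, by omega⟩, ?_⟩
        simp [doubleStarlikeTree, vertexDist, Fin.ext_iff, -Fin.val_eq_zero_iff]
        omega
    · by_cases hc : c.val = C
      · refine ⟨.inr (.inr ⟨i₀, ⟨0, j₀.pos⟩⟩), ?_⟩
        simp [doubleStarlikeTree, vertexDist, Nat.dist, hc, -Fin.val_eq_zero_iff]
      · refine ⟨.inl ⟨c + 1, by omega⟩, ?_⟩
        simp [doubleStarlikeTree, vertexDist, Fin.ext_iff, -Fin.val_eq_zero_iff]
        omega
  · by_cases hout : ∃ j₀ : Fin (A i), u = .inr (.inl ⟨i, j₀⟩) ∧ j < j₀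
    · obtain ⟨j₀, rfl, hlt⟩ := hout
      refine ⟨.inr (.inl ⟨i, ⟨j + 1, by omega⟩⟩), ?_⟩
      simp [doubleStarlikeTree, vertexDist, Nat.dist, Fin.ext_iff, -Fin.val_eq_zero_iff]
      omega
    · by_cases hj : j.val = 0
      · refine ⟨.inl ⟨0, by omega⟩, by simp [doubleStarlikeTree, hj], ?_⟩
        rcases u with c₀ | ⟨i₀, j₀⟩ | ⟨i₀, j₀⟩
        · simp [vertexDist, Nat.dist, hj]
        · have hi : i ≠ i₀ := by
            rintro rfl
            refine hout ⟨j₀, rfl, ?_⟩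
            by_contra hle
            exact h (by rw [Fin.ext (show j.val = j₀.val by omega)])
          simp [vertexDist, hj, hi]
        · simp [vertexDist, hj]
          omega
      · refine ⟨.inr (.inl ⟨i, ⟨j - 1, by omega⟩⟩), ?_, ?_⟩
        · simp [doubleStarlikeTree, Fin.ext_iff, -Fin.val_eq_zero_iff]
          omega
        rcases u with c₀ | ⟨i₀, j₀⟩ | ⟨i₀, j₀⟩
        · simp only [vertexDist]
          omega
        · simp only [vertexDist, Nat.dist]
          split_ifs with hi
          · subst hi
            have hlt : ¬ j < j₀ := fun hlt => hout ⟨j₀, rfl, hlt⟩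
            have hne : j.val ≠ j₀.val := fun h' => h (by rw [Fin.ext h'])
            omega
          · omega
        · simp only [vertexDist]
          omega
  · by_cases hout : ∃ j₀ : Fin (B i), u = .inr (.inr ⟨i, j₀⟩) ∧ j < j₀
    · obtain ⟨j₀, rfl, hlt⟩ := hout
      refine ⟨.inr (.inr ⟨i, ⟨j + 1, by omega⟩⟩), ?_⟩
      simp [doubleStarlikeTree, vertexDist, Nat.dist, Fin.ext_iff, -Fin.val_eq_zero_iff]
      omega
    · by_cases hj : j.val = 0
      · refine ⟨.inl ⟨C, by omega⟩, by simp [doubleStarlikeTree, hj], ?_⟩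
        rcases u with c₀ | ⟨i₀, j₀⟩ | ⟨i₀, j₀⟩
        · simp [vertexDist, Nat.dist, hj]
          omega
        · simp [vertexDist, hj]
          omega
        · have hi : i ≠ i₀ := by
            rintro rfl
            refine hout ⟨j₀, rfl, ?_⟩
            by_contra hle
            exact h (by rw [Fin.ext (show j.val = j₀.val by omega)])
          simp [vertexDist, hj, hi]
      · refine ⟨.inr (.inr ⟨i, ⟨j - 1, by omega⟩⟩), ?_, ?_⟩
        · simp [doubleStarlikeTree, Fin.ext_iff, -Fin.val_eq_zero_iff]
          omega
        rcases u with c₀ | ⟨i₀, j₀⟩ | ⟨i₀, j₀⟩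
        · simp only [vertexDist]
          omega
        · simp only [vertexDist]
          omega
        · simp only [vertexDist, Nat.dist]
          split_ifs with hi
          · subst hi
            have hlt : ¬ j < j₀ := fun hlt => hout ⟨j₀, rfl, hlt⟩
            have hne : j.val ≠ j₀.val := fun h' => h (by rw [Fin.ext h'])
            omega
          · omega

theorem dist_eq_vertexDist
    (u v : Fin (C + 1) ⊕ ((i : Fin k) × Fin (A i)) ⊕ ((i : Fin m) × Fin (B i))) :
    (doubleStarlikeTree C k m A B).dist u v = vertexDist C u v :=
  SimpleGraph.dist_eq_of_descent (vertexDist C u)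
    (by rcases u with c | ⟨i, j⟩ | ⟨i, j⟩ <;> simp [vertexDist])
    (vertexDist_le_of_adj u) (exists_adj_vertexDist u) v

theorem two_mul_transmission_inl (c : Fin (C + 1)) :
    2 * transmission (doubleStarlikeTree C k m A B) (.inl c) =
      c.val * (c.val + 1) + (C + 1 - c.val) * (C + 1 - c.val - 1) +
      (∑ i, (A i * (2 * (c.val + 1)) + A i * (A i - 1)) +
        ∑ i, (B i * (2 * (C - c.val + 1)) + B i * (B i - 1))) := by
  simp only [transmission, dist_eq_vertexDist, Fintype.sum_sum_type, Fintype.sum_sigma,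
    vertexDist, mul_add 2 (Finset.sum _ _), two_mul_sum_fin_natDist _ _ c.2.le]
  simp only [Finset.mul_sum Finset.univ (fun i => Finset.sum _ _) 2, two_mul_sum_fin_add]

theorem two_mul_sum_ite_fin {n : ℕ} (L : Fin n → ℕ) (i : Fin n) (j : Fin (L i)) :
    2 * ∑ i', ∑ j' : Fin (L i'), (if i' = i then Nat.dist j.val j'.val else j.val + 2 + j'.val) =
      ∑ i', if i' = i then j.val * (j.val + 1) + (L i' - j.val) * (L i' - j.val - 1)
        else L i' * (2 * (j.val + 2)) + L i' * (L i' - 1) := by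
  rw [Finset.mul_sum]
  refine Finset.sum_congr rfl fun i' _ => ?_
  split_ifs with h
  · subst h
    exact two_mul_sum_fin_natDist _ _ j.2.le
  · exact two_mul_sum_fin_add _ _

theorem two_mul_transmission_inr_inl (i : Fin k) (j : Fin (A i)) :
    2 * transmission (doubleStarlikeTree C k m A B) (.inr (.inl ⟨i, j⟩)) =
      (C + 1) * (2 * (j.val + 1)) + (C + 1) * (C + 1 - 1) +
      ((∑ i', if i' = i then j.val * (j.val + 1) + (A i' - j.val) * (A i' - j.val - 1)
        else A i' * (2 * (j.val + 2)) + A i' * (A i' - 1)) +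
        ∑ i', (B i' * (2 * (j.val + C + 2)) + B i' * (B i' - 1))) := by
  simp only [transmission, dist_eq_vertexDist, Fintype.sum_sum_type, Fintype.sum_sigma,
    vertexDist, mul_add 2 (Finset.sum _ _), two_mul_sum_ite_fin, two_mul_sum_fin_add]
  simp only [Finset.mul_sum Finset.univ (fun i => Finset.sum _ _) 2, two_mul_sum_fin_add]

theorem two_mul_transmission_inr_inr (i : Fin m) (j : Fin (B i)) :
    2 * transmission (doubleStarlikeTree C k m A B) (.inr (.inr ⟨i, j⟩)) =
      (C + 1) * (2 * (j.val + 1)) + (C + 1) * (C + 1 - 1) +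
      (∑ i', (A i' * (2 * (j.val + C + 2)) + A i' * (A i' - 1)) +
        ∑ i', if i' = i then j.val * (j.val + 1) + (B i' - j.val) * (B i' - j.val - 1)
          else B i' * (2 * (j.val + 2)) + B i' * (B i' - 1)) := by
  have hrev : ∑ c : Fin (C + 1), (j.val + 1 + (C - c.val)) =
      ∑ c : Fin (C + 1), (j.val + 1 + c.val) := by
    rw [← Equiv.sum_comp Fin.revPerm]
    refine Finset.sum_congr rfl fun c _ => ?_
    rw [Fin.revPerm_apply, Fin.val_rev]
    omega
  simp only [transmission, dist_eq_vertexDist, Fintype.sum_sum_type, Fintype.sum_sigma,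
    vertexDist, hrev, mul_add 2 (Finset.sum _ _), two_mul_sum_ite_fin, two_mul_sum_fin_add]
  simp only [Finset.mul_sum Finset.univ (fun i => Finset.sum _ _) 2, two_mul_sum_fin_add]

theorem transmission_hTree_inl (t : ℕ) (c : Fin (1 + t + 1)) :
    transmission
        (doubleStarlikeTree (1 + t) 2 2 ![6 + 2 * t, 5 + 2 * t] ![2 + t, 1]) (.inl c) =
      6 * t ^ 2 + 32 * t + 44 + c.val * (c.val + 7 + 2 * t) := by
  have h := two_mul_transmission_inl (A := ![6 + 2 * t, 5 + 2 * t]) (B := ![2 + t, 1]) c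
  obtain ⟨e, he⟩ := Nat.exists_eq_add_of_le (Nat.le_of_lt_succ c.2)
  have e₁ : 1 + t - c.val = e := by omega
  have e₂ : 1 + t + 1 - c.val = e + 1 := by omega
  simp [e₁, e₂] at h
  have he' : (e : ℤ) = 1 + t - c := by omega
  zify at h ⊢
  rw [he'] at h
  linarith

theorem transmission_hTree_inr_inl_zero (t : ℕ) (j : Fin (6 + 2 * t)) :
    transmission
        (doubleStarlikeTree (1 + t) 2 2 ![6 + 2 * t, 5 + 2 * t] ![2 + t, 1]) (.inr (.inl ⟨0, j⟩)) =
      6 * t ^ 2 + 32 * t + 44 + (j.val + 1) * (j.val + 1 + (3 + 2 * t)) := by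
  have h := two_mul_transmission_inr_inl (C := 1 + t) (A := ![6 + 2 * t, 5 + 2 * t])
    (B := ![2 + t, 1]) 0 j
  obtain ⟨e, he⟩ := Nat.exists_eq_add_of_le (Nat.succ_le_of_lt j.2)
  have e₁ : 6 + 2 * t - j.val = e + 1 := by omega
  simp [e₁] at h
  have he' : (e : ℤ) = 5 + 2 * t - j := by omega
  zify at h ⊢
  rw [he'] at h
  linarith

theorem transmission_hTree_inr_inl_one (t : ℕ) (j : Fin (5 + 2 * t)) :
    transmission
        (doubleStarlikeTree (1 + t) 2 2 ![6 + 2 * t, 5 + 2 * t] ![2 + t, 1]) (.inr (.inl ⟨1, j⟩)) =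
      6 * t ^ 2 + 32 * t + 44 + (j.val + 1) * (j.val + 1 + (5 + 2 * t)) := by
  have h := two_mul_transmission_inr_inl (C := 1 + t) (A := ![6 + 2 * t, 5 + 2 * t])
    (B := ![2 + t, 1]) 1 j
  obtain ⟨e, he⟩ := Nat.exists_eq_add_of_le (Nat.succ_le_of_lt j.2)
  have e₁ : 5 + 2 * t - j.val = e + 1 := by omega
  simp [e₁] at h
  have he' : (e : ℤ) = 4 + 2 * t - j := by omega
  zify at h ⊢
  rw [he'] at h
  linarith

theorem transmission_hTree_inr_inr_zero (t : ℕ) (j : Fin (2 + t)) :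
    transmission
        (doubleStarlikeTree (1 + t) 2 2 ![6 + 2 * t, 5 + 2 * t] ![2 + t, 1]) (.inr (.inr ⟨0, j⟩)) =
      6 * t ^ 2 + 32 * t + 44 + ((1 + t) * (8 + 3 * t) +
        (j.val + 1) * (j.val + 1 + (11 + 4 * t))) := by
  have h := two_mul_transmission_inr_inr (C := 1 + t) (A := ![6 + 2 * t, 5 + 2 * t])
    (B := ![2 + t, 1]) 0 j
  obtain ⟨e, he⟩ := Nat.exists_eq_add_of_le (Nat.succ_le_of_lt j.2)
  have e₁ : 2 + t - j.val = e + 1 := by omega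
  simp [e₁] at h
  have he' : (e : ℤ) = 1 + t - j := by omega
  zify at h ⊢
  rw [he'] at h
  linarith

theorem transmission_hTree_inr_inr_one (t : ℕ) (j : Fin 1) :
    transmission
        (doubleStarlikeTree (1 + t) 2 2 ![6 + 2 * t, 5 + 2 * t] ![2 + t, 1]) (.inr (.inr ⟨1, j⟩)) =
      6 * t ^ 2 + 32 * t + 44 + ((1 + t) * (8 + 3 * t) + (14 + 6 * t)) := by
  have h := two_mul_transmission_inr_inr (C := 1 + t) (A := ![6 + 2 * t, 5 + 2 * t])
    (B := ![2 + t, 1]) 1 j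
  obtain rfl : j = 0 := Subsingleton.elim _ _
  simp at h
  linarith

theorem hTree_vertex_cases {t : ℕ}
    {p : (Fin (1 + t + 1) ⊕ ((i : Fin 2) × Fin (![6 + 2 * t, 5 + 2 * t] i)) ⊕
      ((i : Fin 2) × Fin (![2 + t, 1] i))) → Prop}
    (inl : ∀ c, p (.inl c))
    (inl_zero : ∀ j : Fin (6 + 2 * t), p (.inr (.inl ⟨0, j⟩)))
    (inl_one : ∀ j : Fin (5 + 2 * t), p (.inr (.inl ⟨1, j⟩)))
    (inr_zero : ∀ j : Fin (2 + t), p (.inr (.inr ⟨0, j⟩)))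
    (inr_one : ∀ j : Fin 1, p (.inr (.inr ⟨1, j⟩))) : ∀ v, p v
  | .inl c => inl c
  | .inr (.inl ⟨0, j⟩) => inl_zero j
  | .inr (.inl ⟨1, j⟩) => inl_one j
  | .inr (.inr ⟨0, j⟩) => inr_zero j
  | .inr (.inr ⟨1, j⟩) => inr_one j

end doubleStarlikeTree

theorem mul_add_strictMono (a : ℕ) : StrictMono fun x : ℕ => x * (x + a) := by
  intro x y h
  exact Nat.mul_lt_mul'' h (by omega)

theorem mul_add_ne_of_between {a r x : ℕ} (n : ℕ) (h₁ : n * (n + a) < r)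
    (h₂ : r < (n + 1) * (n + 1 + a)) : x * (x + a) ≠ r := by
  rintro rfl
  have h₃ := (mul_add_strictMono a).lt_iff_lt.1 h₁
  have h₄ := (mul_add_strictMono a).lt_iff_lt.1 h₂
  omega

/-- For every nonnegative integer `t`, the H-tree `H(1+t; 6+2t, 5+2t; 2+t, 1)` is
transmission irregular. -/
theorem hTree_family_one_TI (t : ℕ) :
    TransmissionIrregular
      (doubleStarlikeTree (1 + t) 2 2 ![6 + 2 * t, 5 + 2 * t] ![2 + t, 1]) := by
  have cc {x y : ℕ} (h : x * (x + 7 + 2 * t) = y * (y + 7 + 2 * t)) : x = y :=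
    (mul_add_strictMono (7 + 2 * t)).injective (by simpa only [← add_assoc] using h)
  have ac {x c : ℕ} (a : ℕ) (ha : a = 3 + 2 * t ∨ a = 5 + 2 * t) (hc : c ≤ 1 + t) :
      (x + 1) * (x + 1 + a) ≠ c * (c + 7 + 2 * t) := by
    rcases Nat.eq_zero_or_pos c with rfl | hpos
    · simp
    · apply mul_add_ne_of_between c <;> rcases ha with rfl | rfl <;> nlinarith
  have aa {x y : ℕ} :
      (x + 1) * (x + 1 + (3 + 2 * t)) ≠ (y + 1) * (y + 1 + (5 + 2 * t)) := by
    apply mul_add_ne_of_between (y + 1) <;> nlinarith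
  have bc {r c : ℕ} (hc : c ≤ 1 + t) (hr : 0 < r) :
      (1 + t) * (8 + 3 * t) + r ≠ c * (c + 7 + 2 * t) := by
    have : c * (c + 7 + 2 * t) ≤ (1 + t) * (8 + 3 * t) := Nat.mul_le_mul hc (by omega)
    omega
  have ba₀ {x y : ℕ} (hy : y < 2 + t) : (x + 1) * (x + 1 + (3 + 2 * t)) ≠
      (1 + t) * (8 + 3 * t) + (y + 1) * (y + 1 + (11 + 4 * t)) := by
    apply mul_add_ne_of_between (y + 3 + t) <;> nlinarith
  have ba₁ {x y : ℕ} (hy : y < 2 + t) : (x + 1) * (x + 1 + (5 + 2 * t)) ≠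
      (1 + t) * (8 + 3 * t) + (y + 1) * (y + 1 + (11 + 4 * t)) := by
    apply mul_add_ne_of_between (y + 2 + t) <;> nlinarith
  have la₀ {x : ℕ} : (x + 1) * (x + 1 + (3 + 2 * t)) ≠
      (1 + t) * (8 + 3 * t) + (14 + 6 * t) := by
    apply mul_add_ne_of_between (t + 3) <;> nlinarith
  have la₁ {x : ℕ} : (x + 1) * (x + 1 + (5 + 2 * t)) ≠
      (1 + t) * (8 + 3 * t) + (14 + 6 * t) := by
    apply mul_add_ne_of_between (t + 2) <;> nlinarith
  have lb {x : ℕ} : (x + 1) * (x + 1 + (11 + 4 * t)) ≠ 14 + 6 * t := by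
    apply mul_add_ne_of_between 1 <;> nlinarith
  have shift {x y : ℕ} (a : ℕ) (h : (x + 1) * (x + 1 + a) = (y + 1) * (y + 1 + a)) : x = y :=
    Nat.succ_injective ((mul_add_strictMono a).injective h)
  intro u v
  induction u using doubleStarlikeTree.hTree_vertex_cases <;>
    induction v using doubleStarlikeTree.hTree_vertex_cases <;> intro h <;>
    simp only [doubleStarlikeTree.transmission_hTree_inl,
      doubleStarlikeTree.transmission_hTree_inr_inl_zero,
      doubleStarlikeTree.transmission_hTree_inr_inl_one,
      doubleStarlikeTree.transmission_hTree_inr_inr_zero,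
      doubleStarlikeTree.transmission_hTree_inr_inr_one, Nat.add_left_cancel_iff] at h
  case inl.inl x y => exact congrArg Sum.inl (Fin.ext (cc h))
  case inl.inl_zero x y => exact absurd h.symm (ac _ (.inl rfl) (Nat.le_of_lt_succ x.2))
  case inl.inl_one x y => exact absurd h.symm (ac _ (.inr rfl) (Nat.le_of_lt_succ x.2))
  case inl.inr_zero x y => exact absurd h.symm (bc (Nat.le_of_lt_succ x.2) (by positivity))
  case inl.inr_one x y => exact absurd h.symm (bc (Nat.le_of_lt_succ x.2) (by positivity))
  case inl_zero.inl x y => exact absurd h (ac _ (.inl rfl) (Nat.le_of_lt_succ y.2))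
  case inl_zero.inl_zero x y => rw [Fin.ext (shift (3 + 2 * t) h)]
  case inl_zero.inl_one x y => exact absurd h aa
  case inl_zero.inr_zero x y => exact absurd h (ba₀ y.2)
  case inl_zero.inr_one x y => exact absurd h la₀
  case inl_one.inl x y => exact absurd h (ac _ (.inr rfl) (Nat.le_of_lt_succ y.2))
  case inl_one.inl_zero x y => exact absurd h.symm aa
  case inl_one.inl_one x y => rw [Fin.ext (shift (5 + 2 * t) h)]
  case inl_one.inr_zero x y => exact absurd h (ba₁ y.2)
  case inl_one.inr_one x y => exact absurd h la₁
  case inr_zero.inl x y => exact absurd h (bc (Nat.le_of_lt_succ y.2) (by positivity))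
  case inr_zero.inl_zero x y => exact absurd h.symm (ba₀ x.2)
  case inr_zero.inl_one x y => exact absurd h.symm (ba₁ x.2)
  case inr_zero.inr_zero x y => rw [Fin.ext (shift (11 + 4 * t) h)]
  case inr_zero.inr_one x y => exact absurd h lb
  case inr_one.inl x y => exact absurd h (bc (Nat.le_of_lt_succ y.2) (by positivity))
  case inr_one.inl_zero x y => exact absurd h.symm la₀
  case inr_one.inl_one x y => exact absurd h.symm la₁
  case inr_one.inr_zero x y => exact absurd h.symm lb
  case inr_one.inr_one x y => rw [Subsingleton.elim x y]
end

section
/- For every nonnegative integer t, the H-trees H(3 + 2t; 8 + 4t, 7 + 4t; 6 + 2t, 1), H(1 + t; 7 + 4t, 6 + 4t; 6 + 3t, 1), and H(2; 7 + 4t, 6 + 4t; 5 + 4t, 1), i.e., the corresponding double starlike trees DS(3 + 2t; 8 + 4t, 7 + 4t; 6 + 2t, 1), DS(1 + t; 7 + 4t, 6 + 4t; 6 + 3t, 1), and DS(2; 7 + 4t, 6 + 4t; 5 + 4t, 1), are all transmission irregular. -/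
theorem SimpleGraph.dist_eq_of_forall_adj {V : Type*} {G : SimpleGraph V} {u : V} {f : V → ℕ}
    (hzero : ∀ v, f v = 0 ↔ v = u) (hadj : ∀ v w, G.Adj v w → f w ≤ f v + 1)
    (hpred : ∀ v, f v ≠ 0 → ∃ w, G.Adj w v ∧ f v = f w + 1) (v : V) : G.dist u v = f v := by
  have upper : ∀ n v, f v = n → ∃ p : G.Walk u v, p.length = n := by
    intro n
    induction n with
    | zero =>
      intro v hv
      obtain rfl := (hzero v).1 hv
      exact ⟨.nil, rfl⟩
    | succ n ih =>
      intro v hv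
      obtain ⟨w, hwv, hw⟩ := hpred v (by omega)
      obtain ⟨p, hp⟩ := ih w (by omega)
      exact ⟨p.concat hwv, by simp [hp]⟩
  have lower : ∀ {a b : V} (p : G.Walk a b), f b ≤ f a + p.length := by
    intro a b p
    induction p with
    | nil => simp
    | cons h p ih =>
      have := hadj _ _ h
      rw [SimpleGraph.Walk.length_cons]
      omega
  obtain ⟨p, hp⟩ := upper _ v rfl
  obtain ⟨q, hq⟩ := (SimpleGraph.Walk.reachable p).exists_walk_length_eq_dist
  have h₁ := SimpleGraph.dist_le p
  have h₂ := lower q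
  have h₃ := (hzero u).2 rfl
  omega

section DoubleStarlike

variable {C k m : ℕ} {A : Fin k → ℕ} {B : Fin m → ℕ}

/-- The length of the path joining two vertices of a double starlike tree. -/
def doubleStarlikeDist (C : ℕ) {k m : ℕ} (A : Fin k → ℕ) (B : Fin m → ℕ) :
    (Fin (C + 1) ⊕ ((i : Fin k) × Fin (A i)) ⊕ ((i : Fin m) × Fin (B i))) →
    (Fin (C + 1) ⊕ ((i : Fin k) × Fin (A i)) ⊕ ((i : Fin m) × Fin (B i))) → ℕ
  | .inl c, .inl c' => (c.val - c'.val) + (c'.val - c.val)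
  | .inl c, .inr (.inl ⟨_, j⟩) => c.val + j.val + 1
  | .inr (.inl ⟨_, j⟩), .inl c => c.val + j.val + 1
  | .inl c, .inr (.inr ⟨_, j⟩) => (C - c.val) + j.val + 1
  | .inr (.inr ⟨_, j⟩), .inl c => (C - c.val) + j.val + 1
  | .inr (.inl ⟨i, j⟩), .inr (.inl ⟨i', j'⟩) =>
    if i = i' then (j.val - j'.val) + (j'.val - j.val) else j.val + j'.val + 2
  | .inr (.inr ⟨i, j⟩), .inr (.inr ⟨i', j'⟩) =>
    if i = i' then (j.val - j'.val) + (j'.val - j.val) else j.val + j'.val + 2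
  | .inr (.inl ⟨_, j⟩), .inr (.inr ⟨_, j'⟩) => j.val + j'.val + C + 2
  | .inr (.inr ⟨_, j⟩), .inr (.inl ⟨_, j'⟩) => j.val + j'.val + C + 2

theorem sigma_fin_ext_iff {ι : Type*} {N : ι → ℕ} {i i' : ι} {j : Fin (N i)} {j' : Fin (N i')} :
    (⟨i, j⟩ : (i : ι) × Fin (N i)) = ⟨i', j'⟩ ↔ i = i' ∧ j.val = j'.val := by
  constructor
  · intro h
    cases h
    simp
  · rintro ⟨rfl, h⟩
    rw [Fin.ext h]

theorem doubleStarlikeDist_eq_zero (x y) : doubleStarlikeDist C A B x y = 0 ↔ y = x := by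
  rcases x with c | ⟨i, j⟩ | ⟨i, j⟩ <;> rcases y with c' | ⟨i', j'⟩ | ⟨i', j'⟩ <;>
    simp only [doubleStarlikeDist, Sum.inl.injEq, Sum.inr.injEq, reduceCtorEq,
      sigma_fin_ext_iff, Fin.ext_iff] <;> (try split_ifs) <;>
    (try simp only [false_iff, not_and]) <;> omega

theorem doubleStarlikeDist_le_of_adj (x y z) (h : (doubleStarlikeTree C k m A B).Adj y z) :
    doubleStarlikeDist C A B x z ≤ doubleStarlikeDist C A B x y + 1 := by
  rw [doubleStarlikeTree, SimpleGraph.fromRel_adj] at h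
  replace h := h.2
  rcases x with c | ⟨i, j⟩ | ⟨i, j⟩ <;> rcases y with c' | ⟨i', j'⟩ | ⟨i', j'⟩ <;>
    rcases z with c'' | ⟨i'', j''⟩ | ⟨i'', j''⟩ <;>
    simp only [doubleStarlikeDist, Fin.ext_iff, or_false, false_or, or_self] at h ⊢ <;>
    (try split_ifs) <;> omega

theorem doubleStarlikeTree_adj_path {c c' : Fin (C + 1)} (h : c.val + 1 = c'.val) :
    (doubleStarlikeTree C k m A B).Adj (.inl c) (.inl c') := by
  simp only [doubleStarlikeTree, SimpleGraph.fromRel_adj, ne_eq, Sum.inl.injEq, Fin.ext_iff]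
  omega

theorem doubleStarlikeTree_adj_hubA {c : Fin (C + 1)} {i : Fin k} {j : Fin (A i)}
    (hc : c.val = 0) (hj : j.val = 0) :
    (doubleStarlikeTree C k m A B).Adj (.inl c) (.inr (.inl ⟨i, j⟩)) := by
  simp only [doubleStarlikeTree, SimpleGraph.fromRel_adj, hc, hj]
  simp

theorem doubleStarlikeTree_adj_hubB {c : Fin (C + 1)} {i : Fin m} {j : Fin (B i)}
    (hc : c.val = C) (hj : j.val = 0) :
    (doubleStarlikeTree C k m A B).Adj (.inl c) (.inr (.inr ⟨i, j⟩)) := by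
  simp [doubleStarlikeTree, SimpleGraph.fromRel_adj, hc, hj]

theorem doubleStarlikeTree_adj_armA {i : Fin k} {j j' : Fin (A i)} (h : j.val + 1 = j'.val) :
    (doubleStarlikeTree C k m A B).Adj (.inr (.inl ⟨i, j⟩)) (.inr (.inl ⟨i, j'⟩)) := by
  simp only [doubleStarlikeTree, SimpleGraph.fromRel_adj, ne_eq, Sum.inr.injEq, Sum.inl.injEq,
    sigma_fin_ext_iff, true_and]
  omega

theorem doubleStarlikeTree_adj_armB {i : Fin m} {j j' : Fin (B i)} (h : j.val + 1 = j'.val) :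
    (doubleStarlikeTree C k m A B).Adj (.inr (.inr ⟨i, j⟩)) (.inr (.inr ⟨i, j'⟩)) := by
  simp only [doubleStarlikeTree, SimpleGraph.fromRel_adj, ne_eq, Sum.inr.injEq,
    sigma_fin_ext_iff, true_and]
  omega

theorem exists_adj_path (x) (c : Fin (C + 1)) (h : doubleStarlikeDist C A B x (.inl c) ≠ 0) :
    ∃ z, (doubleStarlikeTree C k m A B).Adj z (.inl c) ∧
      doubleStarlikeDist C A B x (.inl c) = doubleStarlikeDist C A B x z + 1 := by
  rcases x with c₀ | ⟨i, j⟩ | ⟨i, j⟩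
  · simp only [doubleStarlikeDist] at h
    rcases lt_or_ge c₀.val c.val with hlt | hge
    · refine ⟨.inl ⟨c.val - 1, by omega⟩, doubleStarlikeTree_adj_path ?_, ?_⟩ <;>
        simp only [doubleStarlikeDist] <;> omega
    · refine ⟨.inl ⟨c.val + 1, by omega⟩, (doubleStarlikeTree_adj_path rfl).symm, ?_⟩
      simp only [doubleStarlikeDist]
      omega
  · by_cases hc : c.val = 0
    · refine ⟨.inr (.inl ⟨i, ⟨0, j.pos⟩⟩), (doubleStarlikeTree_adj_hubA hc rfl).symm, ?_⟩
      simp only [doubleStarlikeDist, if_true]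
      omega
    · refine ⟨.inl ⟨c.val - 1, by omega⟩, doubleStarlikeTree_adj_path ?_, ?_⟩ <;>
        simp only [doubleStarlikeDist] <;> omega
  · by_cases hc : c.val = C
    · refine ⟨.inr (.inr ⟨i, ⟨0, j.pos⟩⟩), (doubleStarlikeTree_adj_hubB hc rfl).symm, ?_⟩
      simp only [doubleStarlikeDist, if_true]
      omega
    · refine ⟨.inl ⟨c.val + 1, by omega⟩, (doubleStarlikeTree_adj_path rfl).symm, ?_⟩
      simp only [doubleStarlikeDist]
      omega

theorem exists_adj_armA (x) (i : Fin k) (j : Fin (A i))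
    (h : doubleStarlikeDist C A B x (.inr (.inl ⟨i, j⟩)) ≠ 0) :
    ∃ z, (doubleStarlikeTree C k m A B).Adj z (.inr (.inl ⟨i, j⟩)) ∧
      doubleStarlikeDist C A B x (.inr (.inl ⟨i, j⟩)) = doubleStarlikeDist C A B x z + 1 := by
  by_cases hx : ∃ j₀ : Fin (A i), x = .inr (.inl ⟨i, j₀⟩) ∧ j.val ≤ j₀.val
  · obtain ⟨j₀, rfl, hle⟩ := hx
    simp only [doubleStarlikeDist, if_true] at h
    refine ⟨.inr (.inl ⟨i, ⟨j.val + 1, by omega⟩⟩), (doubleStarlikeTree_adj_armA rfl).symm, ?_⟩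
    simp only [doubleStarlikeDist, if_true]
    omega
  have hx' : ∀ j₀ : Fin (A i), x = .inr (.inl ⟨i, j₀⟩) → j₀.val < j.val := by
    simpa using hx
  by_cases hj : j.val = 0
  · refine ⟨.inl 0, doubleStarlikeTree_adj_hubA rfl hj, ?_⟩
    rcases x with c₀ | ⟨i₀, j₀⟩ | ⟨i₀, j₀⟩ <;> simp only [doubleStarlikeDist, Fin.val_zero]
    · omega
    · split_ifs with hi
      · subst hi
        have := hx' j₀ rfl
        omega
      · omega
    · omega
  · refine ⟨.inr (.inl ⟨i, ⟨j.val - 1, by omega⟩⟩), doubleStarlikeTree_adj_armA ?_, ?_⟩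
    · simp only
      omega
    rcases x with c₀ | ⟨i₀, j₀⟩ | ⟨i₀, j₀⟩ <;> simp only [doubleStarlikeDist]
    · omega
    · split_ifs with hi
      · subst hi
        have := hx' j₀ rfl
        omega
      · omega
    · omega

theorem exists_adj_armB (x) (i : Fin m) (j : Fin (B i))
    (h : doubleStarlikeDist C A B x (.inr (.inr ⟨i, j⟩)) ≠ 0) :
    ∃ z, (doubleStarlikeTree C k m A B).Adj z (.inr (.inr ⟨i, j⟩)) ∧
      doubleStarlikeDist C A B x (.inr (.inr ⟨i, j⟩)) = doubleStarlikeDist C A B x z + 1 := by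
  by_cases hx : ∃ j₀ : Fin (B i), x = .inr (.inr ⟨i, j₀⟩) ∧ j.val ≤ j₀.val
  · obtain ⟨j₀, rfl, hle⟩ := hx
    simp only [doubleStarlikeDist, if_true] at h
    refine ⟨.inr (.inr ⟨i, ⟨j.val + 1, by omega⟩⟩), (doubleStarlikeTree_adj_armB rfl).symm, ?_⟩
    simp only [doubleStarlikeDist, if_true]
    omega
  have hx' : ∀ j₀ : Fin (B i), x = .inr (.inr ⟨i, j₀⟩) → j₀.val < j.val := by
    simpa using hx
  by_cases hj : j.val = 0
  · refine ⟨.inl (Fin.last C), doubleStarlikeTree_adj_hubB rfl hj, ?_⟩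
    rcases x with c₀ | ⟨i₀, j₀⟩ | ⟨i₀, j₀⟩ <;> simp only [doubleStarlikeDist, Fin.val_last]
    · omega
    · omega
    · split_ifs with hi
      · subst hi
        have := hx' j₀ rfl
        omega
      · omega
  · refine ⟨.inr (.inr ⟨i, ⟨j.val - 1, by omega⟩⟩), doubleStarlikeTree_adj_armB ?_, ?_⟩
    · simp only
      omega
    rcases x with c₀ | ⟨i₀, j₀⟩ | ⟨i₀, j₀⟩ <;> simp only [doubleStarlikeDist]
    · omega
    · omega
    · split_ifs with hi
      · subst hi
        have := hx' j₀ rfl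
        omega
      · omega

theorem exists_adj_doubleStarlikeDist (x y) (h : doubleStarlikeDist C A B x y ≠ 0) :
    ∃ z, (doubleStarlikeTree C k m A B).Adj z y ∧
      doubleStarlikeDist C A B x y = doubleStarlikeDist C A B x z + 1 := by
  rcases y with c | ⟨i, j⟩ | ⟨i, j⟩
  · exact exists_adj_path x c h
  · exact exists_adj_armA x i j h
  · exact exists_adj_armB x i j h

theorem dist_doubleStarlikeTree (x y) :
    (doubleStarlikeTree C k m A B).dist x y = doubleStarlikeDist C A B x y :=
  SimpleGraph.dist_eq_of_forall_adj (doubleStarlikeDist_eq_zero x)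
    (doubleStarlikeDist_le_of_adj x) (exists_adj_doubleStarlikeDist x) y

theorem sum_range_two_mul_min (j N : ℕ) (h : j < N) :
    ∑ l ∈ Finset.range N, 2 * (min (j : ℤ) l + 1) = (j + 1) * (2 * N - j) := by
  induction N, h using Nat.le_induction with
  | base =>
    have : ∀ n : ℕ, n ≤ j → ∑ l ∈ Finset.range (n + 1), 2 * (min (j : ℤ) l + 1)
        = (n + 1) * (n + 2) := by
      intro n
      induction n with
      | zero => simp
      | succ n ih =>
        intro hn
        rw [Finset.sum_range_succ, ih (by omega), min_eq_right (by exact_mod_cast hn)]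
        push_cast
        ring
    rw [Nat.succ_eq_add_one, this j le_rfl]
    push_cast
    ring
  | succ N hN ih =>
    rw [Finset.sum_range_succ, ih, min_eq_left (by exact_mod_cast (by omega : j ≤ N))]
    push_cast
    ring

theorem sum_fin_abs_sub (N : ℕ) (j : Fin N) :
    ∑ l : Fin N, (((j.val - l.val + (l.val - j.val) : ℕ) : ℤ) - l)
      = N * (j + 2) - (j + 1) * (2 * N - j) := by
  rw [← sum_range_two_mul_min j N j.isLt, Finset.sum_range, eq_sub_iff_add_eq,
    ← Finset.sum_add_distrib, Finset.sum_congr rfl (g := fun _ => (j : ℤ) + 2)]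
  · simp
  · intro l _
    rcases le_total j.val l.val with h | h
    · rw [min_eq_left (by exact_mod_cast h)]
      omega
    · rw [min_eq_right (by exact_mod_cast h)]
      omega

theorem transmission_path (c : Fin (C + 1)) :
    (transmission (doubleStarlikeTree C k m A B) (.inl c) : ℤ)
      = transmission (doubleStarlikeTree C k m A B) (.inl 0)
        + c * (∑ i, (A i : ℤ) - ∑ i, (B i : ℤ) + c - C) := by
  rw [← sub_eq_iff_eq_add']
  simp only [transmission, dist_doubleStarlikeTree]
  push_cast
  rw [← Finset.sum_sub_distrib, Fintype.sum_sum_type, Fintype.sum_sum_type, Fintype.sum_sigma,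
    Fintype.sum_sigma]
  have hpath := sum_fin_abs_sub (C + 1) c
  have hA : ∀ i, ∑ j : Fin (A i), ((doubleStarlikeDist C A B (.inl c) (.inr (.inl ⟨i, j⟩)) : ℤ)
      - doubleStarlikeDist C A B (.inl 0) (.inr (.inl ⟨i, j⟩))) = A i * c := by
    intro i
    rw [Finset.sum_congr rfl (g := fun _ => (c : ℤ))]
    · simp
    · intro j _
      simp only [doubleStarlikeDist, Fin.val_zero]
      omega
  have hB : ∀ i, ∑ j : Fin (B i), ((doubleStarlikeDist C A B (.inl c) (.inr (.inr ⟨i, j⟩)) : ℤ)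
      - doubleStarlikeDist C A B (.inl 0) (.inr (.inr ⟨i, j⟩))) = B i * (-c) := by
    intro i
    rw [Finset.sum_congr rfl (g := fun _ => (-c : ℤ))]
    · simp
    · intro j _
      simp only [doubleStarlikeDist, Fin.val_zero]
      omega
  simp only [hA, hB, ← Finset.sum_mul]
  simp only [doubleStarlikeDist, Fin.val_zero, Nat.zero_sub, Nat.sub_zero, Nat.zero_add]
  rw [hpath]
  push_cast
  ring

theorem transmission_armA (i : Fin k) (j : Fin (A i)) :
    (transmission (doubleStarlikeTree C k m A B) (.inr (.inl ⟨i, j⟩)) : ℤ)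
      = transmission (doubleStarlikeTree C k m A B) (.inl 0)
        + (j + 1) * (C + 1 + ∑ i, (A i : ℤ) + ∑ i, (B i : ℤ) - 2 * A i + j) := by
  rw [← sub_eq_iff_eq_add']
  simp only [transmission, dist_doubleStarlikeTree]
  push_cast
  rw [← Finset.sum_sub_distrib, Fintype.sum_sum_type, Fintype.sum_sum_type, Fintype.sum_sigma,
    Fintype.sum_sigma]
  have hpath : ∀ c, (doubleStarlikeDist C A B (.inr (.inl ⟨i, j⟩)) (.inl c) : ℤ)
      - doubleStarlikeDist C A B (.inl 0) (.inl c) = j + 1 := by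
    intro c
    simp only [doubleStarlikeDist, Fin.val_zero]
    omega
  have hB : ∀ i' (j' : Fin (B i')),
      (doubleStarlikeDist C A B (.inr (.inl ⟨i, j⟩)) (.inr (.inr ⟨i', j'⟩)) : ℤ)
        - doubleStarlikeDist C A B (.inl 0) (.inr (.inr ⟨i', j'⟩)) = j + 1 := by
    intro i' j'
    simp only [doubleStarlikeDist, Fin.val_zero]
    omega
  have hA : ∀ i', ∑ j' : Fin (A i'),
      ((doubleStarlikeDist C A B (.inr (.inl ⟨i, j⟩)) (.inr (.inl ⟨i', j'⟩)) : ℤ)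
        - doubleStarlikeDist C A B (.inl 0) (.inr (.inl ⟨i', j'⟩)))
      = A i' * (j + 1) - if i = i' then (j + 1) * (2 * (A i : ℤ) - j) else 0 := by
    intro i'
    split_ifs with hi
    · subst hi
      have harm := sum_fin_abs_sub (A i) j
      rw [Finset.sum_congr rfl (g := fun l : Fin (A i) =>
        (((j.val - l.val + (l.val - j.val) : ℕ) : ℤ) - l) + (-1)), Finset.sum_add_distrib, harm]
      · simp
        ring
      · intro l _
        simp only [doubleStarlikeDist, Fin.val_zero, if_true]
        omega
    · rw [Finset.sum_congr rfl (g := fun _ => (j + 1 : ℤ))]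
      · simp
      · intro l _
        simp only [doubleStarlikeDist, Fin.val_zero, if_neg hi]
        omega
  simp only [hpath, hA, hB, Finset.sum_sub_distrib, ← Finset.sum_mul, Finset.sum_const,
    Finset.card_univ, Fintype.card_fin, Finset.sum_ite_eq, Finset.mem_univ, if_true, nsmul_eq_mul]
  push_cast
  ring

theorem transmission_armB (i : Fin m) (j : Fin (B i)) :
    (transmission (doubleStarlikeTree C k m A B) (.inr (.inr ⟨i, j⟩)) : ℤ)
      = transmission (doubleStarlikeTree C k m A B) (.inl 0)
        + C * (∑ i, (A i : ℤ) - ∑ i, (B i : ℤ))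
        + (j + 1) * (C + 1 + ∑ i, (A i : ℤ) + ∑ i, (B i : ℤ) - 2 * B i + j) := by
  have hlast := transmission_path (A := A) (B := B) (Fin.last C)
  rw [Fin.val_last, add_sub_cancel_right] at hlast
  rw [← hlast, ← sub_eq_iff_eq_add']
  simp only [transmission, dist_doubleStarlikeTree]
  push_cast
  rw [← Finset.sum_sub_distrib, Fintype.sum_sum_type, Fintype.sum_sum_type, Fintype.sum_sigma,
    Fintype.sum_sigma]
  have hpath : ∀ c, (doubleStarlikeDist C A B (.inr (.inr ⟨i, j⟩)) (.inl c) : ℤ)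
      - doubleStarlikeDist C A B (.inl (Fin.last C)) (.inl c) = j + 1 := by
    intro c
    simp only [doubleStarlikeDist, Fin.val_last]
    omega
  have hA : ∀ i' (j' : Fin (A i')),
      (doubleStarlikeDist C A B (.inr (.inr ⟨i, j⟩)) (.inr (.inl ⟨i', j'⟩)) : ℤ)
        - doubleStarlikeDist C A B (.inl (Fin.last C)) (.inr (.inl ⟨i', j'⟩)) = j + 1 := by
    intro i' j'
    simp only [doubleStarlikeDist, Fin.val_last]
    omega
  have hB : ∀ i', ∑ j' : Fin (B i'),
      ((doubleStarlikeDist C A B (.inr (.inr ⟨i, j⟩)) (.inr (.inr ⟨i', j'⟩)) : ℤ)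
        - doubleStarlikeDist C A B (.inl (Fin.last C)) (.inr (.inr ⟨i', j'⟩)))
      = B i' * (j + 1) - if i = i' then (j + 1) * (2 * (B i : ℤ) - j) else 0 := by
    intro i'
    split_ifs with hi
    · subst hi
      have harm := sum_fin_abs_sub (B i) j
      rw [Finset.sum_congr rfl (g := fun l : Fin (B i) =>
        (((j.val - l.val + (l.val - j.val) : ℕ) : ℤ) - l) + (-1)), Finset.sum_add_distrib, harm]
      · simp
        ring
      · intro l _
        simp only [doubleStarlikeDist, Fin.val_last, if_true]
        omega
    · rw [Finset.sum_congr rfl (g := fun _ => (j + 1 : ℤ))]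
      · simp
      · intro l _
        simp only [doubleStarlikeDist, Fin.val_last, if_neg hi]
        omega
  simp only [hpath, hA, hB, Finset.sum_sub_distrib, ← Finset.sum_mul, Finset.sum_const,
    Finset.card_univ, Fintype.card_fin, Finset.sum_ite_eq, Finset.mem_univ, if_true, nsmul_eq_mul]
  push_cast
  ring

theorem mul_add_self_injOn {p : ℤ} (hp : 0 ≤ p) {x y : ℤ} (hx : 0 ≤ x) (hy : 0 ≤ y)
    (h : x * (x + p) = y * (y + p)) : x = y := by
  rcases lt_trichotomy x y with hlt | heq | hlt
  · nlinarith
  · exact heq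
  · nlinarith

/-- Up to a common additive constant, the transmissions along each path of a double starlike tree
are given by a quadratic; it is enough that each of these quadratics is increasing and that no
two of them share a value. -/
theorem transmissionIrregular_doubleStarlikeTree (s : ℤ) (p : Fin k → ℤ) (q : Fin m → ℤ)
    (hs : s = ∑ i, (A i : ℤ) - ∑ i, (B i : ℤ) - C)
    (hp : ∀ i, p i = C + ∑ i, (A i : ℤ) + ∑ i, (B i : ℤ) - 2 * A i)
    (hq : ∀ i, q i = C + ∑ i, (A i : ℤ) + ∑ i, (B i : ℤ) - 2 * B i)
    (hs₀ : 0 ≤ s) (hp₀ : ∀ i, 0 ≤ p i) (hq₀ : ∀ i, 0 ≤ q i)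
    (hPA : ∀ i, ∀ c a : ℤ, 0 ≤ c → c ≤ C → 1 ≤ a → a ≤ A i →
      c * (c + s) ≠ a * (a + p i))
    (hPB : ∀ i, ∀ c b : ℤ, 0 ≤ c → c ≤ C → 1 ≤ b → b ≤ B i →
      c * (c + s) ≠ C * (C + s) + b * (b + q i))
    (hAA : ∀ i i', i < i' → ∀ a a' : ℤ, 1 ≤ a → a ≤ A i → 1 ≤ a' → a' ≤ A i' →
      a * (a + p i) ≠ a' * (a' + p i'))
    (hAB : ∀ i i', ∀ a b : ℤ, 1 ≤ a → a ≤ A i → 1 ≤ b → b ≤ B i' →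
      a * (a + p i) ≠ C * (C + s) + b * (b + q i'))
    (hBB : ∀ i i', i < i' → ∀ b b' : ℤ, 1 ≤ b → b ≤ B i → 1 ≤ b' → b' ≤ B i' →
      b * (b + q i) ≠ b' * (b' + q i')) :
    TransmissionIrregular (doubleStarlikeTree C k m A B) := by
  have hP : ∀ c : Fin (C + 1), (transmission (doubleStarlikeTree C k m A B) (.inl c) : ℤ)
      = transmission (doubleStarlikeTree C k m A B) (.inl 0) + c * (c + s) := by
    intro c
    rw [transmission_path, hs]
    ring
  have hA : ∀ i (j : Fin (A i)),
      (transmission (doubleStarlikeTree C k m A B) (.inr (.inl ⟨i, j⟩)) : ℤ)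
      = transmission (doubleStarlikeTree C k m A B) (.inl 0)
        + (j + 1 : ℤ) * ((j + 1 : ℤ) + p i) := by
    intro i j
    rw [transmission_armA, hp]
    ring
  have hB : ∀ i (j : Fin (B i)),
      (transmission (doubleStarlikeTree C k m A B) (.inr (.inr ⟨i, j⟩)) : ℤ)
      = transmission (doubleStarlikeTree C k m A B) (.inl 0)
        + (C * (C + s) + (j + 1 : ℤ) * ((j + 1 : ℤ) + q i)) := by
    intro i j
    rw [transmission_armB, hq, hs]
    ring
  generalize (transmission (doubleStarlikeTree C k m A B) (.inl 0) : ℤ) = T at hP hA hB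
  intro x y hxy
  replace hxy : (transmission (doubleStarlikeTree C k m A B) x : ℤ)
      = transmission (doubleStarlikeTree C k m A B) y := by rw [hxy]
  rcases x with c | ⟨i, j⟩ | ⟨i, j⟩ <;> rcases y with c' | ⟨i', j'⟩ | ⟨i', j'⟩ <;>
    simp only [hP, hA, hB, add_right_inj] at hxy
  · have := mul_add_self_injOn hs₀ (by omega) (by omega) hxy
    rw [Fin.ext (by exact_mod_cast this : c.val = c'.val)]
  · exact absurd hxy (hPA i' _ _ (by omega) (by omega) (by omega) (by omega))
  · exact absurd hxy (hPB i' _ _ (by omega) (by omega) (by omega) (by omega))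
  · exact absurd hxy.symm (hPA i _ _ (by omega) (by omega) (by omega) (by omega))
  · rcases lt_trichotomy i i' with hlt | rfl | hlt
    · exact absurd hxy (hAA i i' hlt _ _ (by omega) (by omega) (by omega) (by omega))
    · have := mul_add_self_injOn (hp₀ i) (by omega) (by omega) hxy
      rw [Fin.ext (by omega : j.val = j'.val)]
    · exact absurd hxy.symm (hAA i' i hlt _ _ (by omega) (by omega) (by omega) (by omega))
  · exact absurd hxy (hAB i i' _ _ (by omega) (by omega) (by omega) (by omega))
  · exact absurd hxy.symm (hPB i _ _ (by omega) (by omega) (by omega) (by omega))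
  · exact absurd hxy.symm (hAB i' i _ _ (by omega) (by omega) (by omega) (by omega))
  · rcases lt_trichotomy i i' with hlt | rfl | hlt
    · exact absurd hxy (hBB i i' hlt _ _ (by omega) (by omega) (by omega) (by omega))
    · have := mul_add_self_injOn (hq₀ i) (by omega) (by omega) hxy
      rw [Fin.ext (by omega : j.val = j'.val)]
    · exact absurd hxy.symm (hBB i' i hlt _ _ (by omega) (by omega) (by omega) (by omega))

end DoubleStarlike

/-- The criterion `transmissionIrregular_doubleStarlikeTree` for an H-tree with a pendent vertex. -/
theorem transmissionIrregular_hTree {C a₁ a₂ b : ℕ} (s p₁ p₂ q r K : ℤ)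
    (hs : s = a₁ + a₂ - b - 1 - C) (hp₁ : p₁ = C + a₂ + b + 1 - a₁)
    (hp₂ : p₂ = C + a₁ + b + 1 - a₂) (hq : q = C + a₁ + a₂ + 1 - b)
    (hr : r = C + a₁ + a₂ + b) (hK : K = C * (C + s))
    (hs₀ : 0 ≤ s) (hp₁₀ : 0 ≤ p₁) (hp₂₀ : 0 ≤ p₂) (hq₀ : 0 ≤ q)
    (hPA₁ : ∀ c a : ℤ, 0 ≤ c → c ≤ C → 1 ≤ a → a ≤ a₁ → c * (c + s) ≠ a * (a + p₁))
    (hPA₂ : ∀ c a : ℤ, 0 ≤ c → c ≤ C → 1 ≤ a → a ≤ a₂ → c * (c + s) ≠ a * (a + p₂))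
    (hAA : ∀ a a' : ℤ, 1 ≤ a → a ≤ a₁ → 1 ≤ a' → a' ≤ a₂ → a * (a + p₁) ≠ a' * (a' + p₂))
    (hA₁B : ∀ a x : ℤ, 1 ≤ a → a ≤ a₁ → 1 ≤ x → x ≤ b → a * (a + p₁) ≠ K + x * (x + q))
    (hA₂B : ∀ a x : ℤ, 1 ≤ a → a ≤ a₂ → 1 ≤ x → x ≤ b → a * (a + p₂) ≠ K + x * (x + q))
    (hA₁ : ∀ a : ℤ, 1 ≤ a → a ≤ a₁ → a * (a + p₁) ≠ K + r)
    (hA₂ : ∀ a : ℤ, 1 ≤ a → a ≤ a₂ → a * (a + p₂) ≠ K + r)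
    (hB : ∀ x : ℤ, 1 ≤ x → x ≤ b → x * (x + q) ≠ r) :
    TransmissionIrregular (doubleStarlikeTree C 2 2 ![a₁, a₂] ![b, 1]) := by
  have hPB : ∀ c x u : ℤ, 0 ≤ c → c ≤ C → 1 ≤ x → 0 ≤ u →
      c * (c + s) ≠ C * (C + s) + x * (x + u) := by
    intro c x u hc hcC hx hu
    have h₁ : c * (c + s) ≤ C * (C + s) := by gcongr
    have h₂ : 0 < x * (x + u) := by positivity
    omega
  subst hK
  refine transmissionIrregular_doubleStarlikeTree s ![p₁, p₂] ![q, r - 1] ?_ ?_ ?_ hs₀ ?_ ?_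
    ?_ ?_ ?_ ?_ ?_ <;>
    simp only [Fin.forall_fin_two, Fin.sum_univ_two, Matrix.cons_val_zero, Matrix.cons_val_one,
      Nat.cast_one, lt_self_iff_false, false_imp_iff, true_and, and_true, Fin.zero_lt_one,
      not_lt_zero, true_imp_iff]
  · omega
  · omega
  · omega
  · exact ⟨hp₁₀, hp₂₀⟩
  · omega
  · exact ⟨hPA₁, hPA₂⟩
  · exact ⟨fun c x h₁ h₂ h₃ _ => hPB c x q h₁ h₂ h₃ hq₀,
      fun c x h₁ h₂ h₃ _ => hPB c x (r - 1) h₁ h₂ h₃ (by omega)⟩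
  · exact hAA
  · refine ⟨⟨hA₁B, ?_⟩, hA₂B, ?_⟩
    · intro a x h₁ h₂ h₃ h₄
      obtain rfl : x = 1 := by omega
      simpa using hA₁ a h₁ h₂
    · intro a x h₁ h₂ h₃ h₄
      obtain rfl : x = 1 := by omega
      simpa using hA₂ a h₁ h₂
  · intro x y h₁ h₂ h₃ h₄
    obtain rfl : y = 1 := by omega
    simpa using hB x h₁ h₂

theorem hTree_three_add_two_mul_TI (t : ℕ) : TransmissionIrregular
    (doubleStarlikeTree (3 + 2 * t) 2 2 ![8 + 4 * t, 7 + 4 * t] ![6 + 2 * t, 1]) := by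
  have ht : (0 : ℤ) ≤ t := by positivity
  apply transmissionIrregular_hTree (5 + 4 * t) (9 + 4 * t) (11 + 4 * t) (13 + 8 * t) (24 + 12 * t)
    ((3 + 2 * t) * (8 + 6 * t)) <;> push_cast
  any_goals ring1
  any_goals positivity
  all_goals generalize (t : ℤ) = t at ht ⊢
  · intro c a _ hc _ ha h
    obtain ⟨d, rfl⟩ : ∃ d, c = a + d := ⟨c - a, by ring⟩
    rcases (by omega : d ≤ 0 ∨ d = 1 ∨ 2 ≤ d) with hd | rfl | hd <;> nlinarith
  · intro c a _ hc _ ha h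
    obtain ⟨d, rfl⟩ : ∃ d, c = a + d := ⟨c - a, by ring⟩
    rcases (by omega : d ≤ 0 ∨ d = 1 ∨ d = 2 ∨ 3 ≤ d) with hd | rfl | rfl | hd
    · nlinarith
    · ring_nf at h
      omega
    all_goals nlinarith
  · intro a a' _ ha _ ha' h
    obtain ⟨d, rfl⟩ : ∃ d, a = a' + d := ⟨a - a', by ring⟩
    rcases (by omega : d ≤ 0 ∨ 1 ≤ d) with hd | hd <;> nlinarith
  · intro a x _ ha _ hx h
    obtain ⟨d, rfl⟩ : ∃ d, x = a + d - (3 + 2 * t) := ⟨x - a + (3 + 2 * t), by ring⟩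
    rcases (by omega : d ≤ 0 ∨ d = 1 ∨ 2 ≤ d) with hd | rfl | hd <;> nlinarith
  · intro a x _ ha _ hx h
    obtain ⟨d, rfl⟩ : ∃ d, x = a + d - (3 + 2 * t) := ⟨x - a + (3 + 2 * t), by ring⟩
    rcases (by omega : d ≤ 0 ∨ d = 1 ∨ 2 ≤ d) with hd | rfl | hd <;> nlinarith
  · intro a _ ha h
    rcases (by omega : a ≤ 2 * t + 3 ∨ 2 * t + 4 ≤ a) with hd | hd <;> nlinarith
  · intro a _ ha h
    rcases (by omega : a ≤ 2 * t + 3 ∨ 2 * t + 4 ≤ a) with hd | hd <;> nlinarith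
  · intro x _ hx h
    rcases (by omega : x ≤ 1 ∨ 2 ≤ x) with hd | hd <;> nlinarith

theorem hTree_one_add_TI (t : ℕ) : TransmissionIrregular
    (doubleStarlikeTree (1 + t) 2 2 ![7 + 4 * t, 6 + 4 * t] ![6 + 3 * t, 1]) := by
  have ht : (0 : ℤ) ≤ t := by positivity
  apply transmissionIrregular_hTree (5 + 4 * t) (7 + 4 * t) (9 + 4 * t) (9 + 6 * t) (20 + 12 * t)
    ((1 + t) * (6 + 5 * t)) <;> push_cast
  any_goals ring1
  any_goals positivity
  all_goals generalize (t : ℤ) = t at ht ⊢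
  · intro c a _ hc _ ha h
    obtain ⟨d, rfl⟩ : ∃ d, c = a + d := ⟨c - a, by ring⟩
    rcases (by omega : d ≤ 0 ∨ 1 ≤ d) with hd | hd <;> nlinarith
  · intro c a _ hc _ ha h
    obtain ⟨d, rfl⟩ : ∃ d, c = a + d := ⟨c - a, by ring⟩
    rcases (by omega : d ≤ 0 ∨ d = 1 ∨ 2 ≤ d) with hd | rfl | hd <;> nlinarith
  · intro a a' _ ha _ ha' h
    obtain ⟨d, rfl⟩ : ∃ d, a = a' + d := ⟨a - a', by ring⟩
    rcases (by omega : d ≤ 0 ∨ 1 ≤ d) with hd | hd <;> nlinarith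
  · intro a x _ ha _ hx h
    obtain ⟨d, rfl⟩ : ∃ d, x = a + d - (1 + t) := ⟨x - a + (1 + t), by ring⟩
    rcases (by omega : d ≤ 0 ∨ 1 ≤ d) with hd | hd <;> nlinarith
  · intro a x _ ha _ hx h
    obtain ⟨d, rfl⟩ : ∃ d, x = a + d - (1 + t) := ⟨x - a + (1 + t), by ring⟩
    rcases (by omega : d ≤ 0 ∨ 1 ≤ d) with hd | hd <;> nlinarith
  · intro a _ ha h
    rcases (by omega : a ≤ t + 2 ∨ t + 3 ≤ a) with hd | hd <;> nlinarith
  · intro a _ ha h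
    rcases (by omega : a ≤ t + 2 ∨ t + 3 ≤ a) with hd | hd <;> nlinarith
  · intro x _ hx h
    rcases (by omega : x ≤ 1 ∨ 2 ≤ x) with hd | hd <;> nlinarith

theorem hTree_two_TI (t : ℕ) : TransmissionIrregular
    (doubleStarlikeTree 2 2 2 ![7 + 4 * t, 6 + 4 * t] ![5 + 4 * t, 1]) := by
  have ht : (0 : ℤ) ≤ t := by positivity
  apply transmissionIrregular_hTree (5 + 4 * t) (7 + 4 * t) (9 + 4 * t) (11 + 4 * t) (20 + 12 * t)
    (14 + 8 * t) <;> push_cast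
  any_goals ring1
  any_goals positivity
  all_goals generalize (t : ℤ) = t at ht ⊢
  · intro c a _ hc _ ha h
    obtain ⟨d, rfl⟩ : ∃ d, c = a + d := ⟨c - a, by ring⟩
    rcases (by omega : d ≤ 0 ∨ 1 ≤ d) with hd | hd <;> nlinarith
  · intro c a _ hc _ ha h
    obtain ⟨d, rfl⟩ : ∃ d, c = a + d := ⟨c - a, by ring⟩
    rcases (by omega : d ≤ 0 ∨ d = 1 ∨ 2 ≤ d) with hd | rfl | hd <;> nlinarith
  · intro a a' _ ha _ ha' h
    obtain ⟨d, rfl⟩ : ∃ d, a = a' + d := ⟨a - a', by ring⟩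
    rcases (by omega : d ≤ 0 ∨ 1 ≤ d) with hd | hd <;> nlinarith
  · intro a x _ ha _ hx h
    obtain ⟨d, rfl⟩ : ∃ d, x = a + d - 2 := ⟨x - a + 2, by ring⟩
    rcases (by omega : d ≤ 0 ∨ 1 ≤ d) with hd | hd <;> nlinarith
  · intro a x _ ha _ hx h
    obtain ⟨d, rfl⟩ : ∃ d, x = a + d - 2 := ⟨x - a + 2, by ring⟩
    rcases (by omega : d ≤ 0 ∨ 1 ≤ d) with hd | hd <;> nlinarith
  · intro a _ ha h
    rcases (by omega : a ≤ 2 ∨ a = 3 ∨ a = 4 ∨ 5 ≤ a) with hd | rfl | rfl | hd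
    · nlinarith
    · omega
    · omega
    · nlinarith
  · intro a _ ha h
    rcases (by omega : a ≤ 2 ∨ a = 3 ∨ a = 4 ∨ 5 ≤ a) with hd | rfl | rfl | hd
    · nlinarith
    · omega
    · omega
    · nlinarith
  · intro x _ hx h
    rcases (by omega : x ≤ 1 ∨ x = 2 ∨ 3 ≤ x) with hd | rfl | hd
    · nlinarith
    · omega
    · nlinarith

/-- For every nonnegative integer `t`, the H-trees `H(3+2t; 8+4t, 7+4t; 6+2t, 1)`,
`H(1+t; 7+4t, 6+4t; 6+3t, 1)`, and `H(2; 7+4t, 6+4t; 5+4t, 1)` are all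
transmission irregular. -/
theorem hTree_families_five_six_seven_TI (t : ℕ) :
    TransmissionIrregular
      (doubleStarlikeTree (3 + 2 * t) 2 2 ![8 + 4 * t, 7 + 4 * t] ![6 + 2 * t, 1]) ∧
    TransmissionIrregular
      (doubleStarlikeTree (1 + t) 2 2 ![7 + 4 * t, 6 + 4 * t] ![6 + 3 * t, 1]) ∧
    TransmissionIrregular
      (doubleStarlikeTree 2 2 2 ![7 + 4 * t, 6 + 4 * t] ![5 + 4 * t, 1]) := by
  exact ⟨hTree_three_add_two_mul_TI t, hTree_one_add_TI t, hTree_two_TI t⟩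
end
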